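/- arXiv:2601.12741 — 5 statements merged into one kernel-verified Lean document; each statement's English description precedes it below -/
import Mathlib

section
/- For all graphs G and G', if p(H,G) = p(H,G') for every graph H, then G and G' are isomorphic. Conversely, if G ≅ G' then p(H,G) = p(H,G') for every graph H. -/
open Filter Topology MeasureTheory

/-- A finite simple undirected graph with vertex set a finite subset of ℕ. -/
structure FGraph where
  verts : Finset ℕ
  Adj : ℕ → ℕ → Prop
  symm : ∀ a b, Adj a b → Adj b a
  irrefl : ∀ a, ¬ Adj a a
  mem : ∀ a b, Adj a b → a ∈ verts ∧ b ∈ verts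

namespace FGraph

/-- Induced subgraph on a set `U` of vertices. -/
def induce (G : FGraph) (U : Finset ℕ) : FGraph where
  verts := U
  Adj a b := a ∈ U ∧ b ∈ U ∧ G.Adj a b
  symm := fun a b ⟨ha, hb, h⟩ => ⟨hb, ha, G.symm a b h⟩
  irrefl := fun a ⟨_, _, h⟩ => G.irrefl a h
  mem := fun _ _ ⟨ha, hb, _⟩ => ⟨ha, hb⟩

/-- Graph isomorphism. -/
def Iso (H G : FGraph) : Prop :=
  ∃ f : ℕ → ℕ, Set.BijOn f ↑H.verts ↑G.verts ∧
    ∀ a ∈ H.verts, ∀ b ∈ H.verts, (H.Adj a b ↔ G.Adj (f a) (f b))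

-- /-- Induced subgraph density `p(H,G)`: the probability that a uniformly random
-- `v(H)`-element subset of `V(G)` induces a subgraph isomorphic to `H`.
-- (When `v(H) > v(G)` this is `0/0 = 0`, matching the convention.) -/
open Classical in
noncomputable def density (H G : FGraph) : ℝ :=
  (((G.verts.powersetCard H.verts.card).filter fun U => Iso H (G.induce U)).card : ℝ) /
    ((G.verts.powersetCard H.verts.card).card : ℝ)

/-- Build a graph on vertex set `V` from an arbitrary relation (symmetrised, loops removed). -/
def ofRel (V : Finset ℕ) (r : ℕ → ℕ → Prop) : FGraph where
  verts := V
  Adj a b := a ∈ V ∧ b ∈ V ∧ a ≠ b ∧ (r a b ∨ r b a)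
  symm := fun _ _ ⟨ha, hb, hne, hr⟩ => ⟨hb, ha, hne.symm, hr.symm⟩
  irrefl := fun _ ⟨_, _, hne, _⟩ => hne rfl
  mem := fun _ _ ⟨ha, hb, _, _⟩ => ⟨ha, hb⟩

/-- The complete graph `K_t` on vertex set `[t] = {1,…,t}`. -/
def completeG (t : ℕ) : FGraph := ofRel (Finset.Icc 1 t) fun _ _ => True

/-- The edgeless graph `I_t` on vertex set `[t] = {1,…,t}`. -/
def edgeless (t : ℕ) : FGraph := ofRel (Finset.Icc 1 t) fun _ _ => False

/-- The graph on `[3]` with exactly one edge `{1,2}`. -/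
def oneEdge3 : FGraph := ofRel (Finset.Icc 1 3) fun a b => a = 1 ∧ b = 2

/-- The path with two edges `{1,2},{2,3}` on `[3]`. -/
def path3 : FGraph := ofRel (Finset.Icc 1 3) fun a b => (a = 1 ∧ b = 2) ∨ (a = 2 ∧ b = 3)

/-- The graph with empty vertex set. -/
def emptyG : FGraph := ofRel ∅ fun _ _ => False

/-- The complement graph. -/
def compl (G : FGraph) : FGraph := ofRel G.verts fun a b => ¬ G.Adj a b

end FGraph

/-- `𝓗` is a complete set of graphs on `V`: every graph with vertex set `V`
is isomorphic to exactly one member of `𝓗`, and all members have vertex set `V`. -/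
def CompleteOn (V : Finset ℕ) (𝓗 : Finset FGraph) : Prop :=
  (∀ H ∈ 𝓗, H.verts = V) ∧
  ∀ G : FGraph, G.verts = V → ∃! H, H ∈ 𝓗 ∧ FGraph.Iso G H

/-- An increasing sequence of graphs. -/
def IncreasingSeq (Gs : ℕ → FGraph) : Prop :=
  ∀ n, (Gs n).verts.card < (Gs (n + 1)).verts.card

/-- `φ` is a limiting graph: the pointwise limit of densities along some
convergent (increasing) sequence of graphs. -/
def IsLimitGraph (φ : FGraph → ℝ) : Prop :=
  ∃ Gs : ℕ → FGraph, IncreasingSeq Gs ∧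
    ∀ H : FGraph, Tendsto (fun n => FGraph.density H (Gs n)) atTop (𝓝 (φ H))

-- /-- `r_H` in the product decomposition: the probability that uniformly random
-- disjoint subsets `U₁, U₂` of `V(H)` of sizes `v(H₁)`, `v(H₂)` induce copies of
-- `H₁` and `H₂` respectively. -/
open Classical in
noncomputable def rval (H H1 H2 : FGraph) : ℝ :=
  let S := ((H.verts.powersetCard H1.verts.card) ×ˢ (H.verts.powersetCard H2.verts.card)).filter
      fun p => Disjoint p.1 p.2
  ((S.filter fun p => FGraph.Iso H1 (H.induce p.1) ∧ FGraph.Iso H2 (H.induce p.2)).card : ℝ) /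
    (S.card : ℝ)

-- `θ` is an embedding of the type `τ` into `G`. -/
def IsEmbOf (τ G : FGraph) (θ : ℕ → ℕ) : Prop :=
  (∀ i ∈ τ.verts, θ i ∈ G.verts) ∧ Set.InjOn θ ↑τ.verts ∧
  ∀ i ∈ τ.verts, ∀ j ∈ τ.verts, (τ.Adj i j ↔ G.Adj (θ i) (θ j))

/-- A `τ`-labelled graph: a graph together with an embedding of `τ` into it. -/
structure LGraph (τ : FGraph) where
  G : FGraph
  θ : ℕ → ℕ
  emb : IsEmbOf τ G θ

/-- `τ`-isomorphism of labelled graphs, expressed on the underlying data. -/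
def LIsoPair (τ : FGraph) (H : FGraph) (ι : ℕ → ℕ) (G : FGraph) (θ : ℕ → ℕ) : Prop :=
  ∃ f : ℕ → ℕ, Set.BijOn f ↑H.verts ↑G.verts ∧
    (∀ a ∈ H.verts, ∀ b ∈ H.verts, (H.Adj a b ↔ G.Adj (f a) (f b))) ∧
    ∀ i ∈ τ.verts, f (ι i) = θ i

/-- `τ`-isomorphism of two `τ`-labelled graphs. -/
def LIso {τ : FGraph} (Hτ Gτ : LGraph τ) : Prop :=
  LIsoPair τ Hτ.G Hτ.θ Gτ.G Gτ.θ

-- /-- The labelled density `p_τ(H^τ, G^τ)`. -/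
open Classical in
noncomputable def ldensity {τ : FGraph} (Hτ Gτ : LGraph τ) : ℝ :=
  ((((Gτ.G.verts \ τ.verts.image Gτ.θ).powersetCard
        (Hτ.G.verts.card - τ.verts.card)).filter
      fun U => LIsoPair τ Hτ.G Hτ.θ (Gτ.G.induce (τ.verts.image Gτ.θ ∪ U)) Gτ.θ).card : ℝ) /
    (((Gτ.G.verts \ τ.verts.image Gτ.θ).powersetCard
        (Hτ.G.verts.card - τ.verts.card)).card : ℝ)

/-- A `τ`-labelled limiting graph. -/
def IsLimitLGraph {τ : FGraph} (φ : LGraph τ → ℝ) : Prop :=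
  ∃ Gs : ℕ → LGraph τ, (∀ n, (Gs n).G.verts.card < (Gs (n + 1)).G.verts.card) ∧
    ∀ Hτ : LGraph τ, Tendsto (fun n => ldensity Hτ (Gs n)) atTop (𝓝 (φ Hτ))

/-- `𝓗` is a complete set of `τ`-labelled graphs on `V`. -/
def LCompleteOn (τ : FGraph) (V : Finset ℕ) (𝓗 : Finset (LGraph τ)) : Prop :=
  (∀ Hτ ∈ 𝓗, Hτ.G.verts = V) ∧
  ∀ Gτ : LGraph τ, Gτ.G.verts = V → ∃! Hτ, Hτ ∈ 𝓗 ∧ LIso Gτ Hτ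

/-- The `τ`-labelled graph `(τ, id)`. -/
def idLabel (τ : FGraph) : LGraph τ :=
  ⟨τ, id, fun _ hi => hi, Set.injOn_id _, fun _ _ _ _ => Iff.rfl⟩

-- /-- The labelled analogue of `rval`. -/
open Classical in
noncomputable def rvalL {τ : FGraph} (Gτ H1 H2 : LGraph τ) : ℝ :=
  let S := ((Gτ.G.verts \ τ.verts.image Gτ.θ).powersetCard (H1.G.verts.card - τ.verts.card) ×ˢ
      (Gτ.G.verts \ τ.verts.image Gτ.θ).powersetCard (H2.G.verts.card - τ.verts.card)).filter
      fun p => Disjoint p.1 p.2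
  ((S.filter fun p =>
      LIsoPair τ H1.G H1.θ (Gτ.G.induce (τ.verts.image Gτ.θ ∪ p.1)) Gτ.θ ∧
      LIsoPair τ H2.G H2.θ (Gτ.G.induce (τ.verts.image Gτ.θ ∪ p.2)) Gτ.θ).card : ℝ) /
    (S.card : ℝ)

/-- Extend a function between Finset-subtypes to a function `ℕ → ℕ`. -/
def toFun {V W : Finset ℕ} (f : ↥V → ↥W) : ℕ → ℕ :=
  fun i => if h : i ∈ V then (f ⟨i, h⟩ : ℕ) else 0

-- /-- `q_{G^τ}`: the probability that a uniformly random injection `θ : [k] → V(|G^τ|)`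
-- is an embedding of `τ` with `(|G^τ|, θ) ≅_τ G^τ`. -/
open Classical in
noncomputable def qval {τ : FGraph} (Gτ : LGraph τ) : ℝ :=
  (Fintype.card {f : ↥τ.verts ↪ ↥Gτ.G.verts //
      IsEmbOf τ Gτ.G (toFun ⇑f) ∧ LIsoPair τ Gτ.G (toFun ⇑f) Gτ.G Gτ.θ} : ℝ) /
  (Fintype.card (↥τ.verts ↪ ↥Gτ.G.verts) : ℝ)

-- /-- The number of embeddings of `τ` into `G`. -/
open Classical in
noncomputable def embCard (τ G : FGraph) : ℕ :=
  Fintype.card {f : ↥τ.verts ↪ ↥G.verts // IsEmbOf τ G (toFun ⇑f)}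

-- /-- The number of automorphisms of `G`. -/
open Classical in
noncomputable def autCard (G : FGraph) : ℕ :=
  Fintype.card {f : ↥G.verts ≃ ↥G.verts //
    ∀ a b : ↥G.verts, G.Adj a b ↔ G.Adj (f a) (f b)}

/-- Build a `τ`-labelled graph from an embedding. -/
def LGraph.mk' (τ G : FGraph) (θ : ℕ → ℕ) (h : IsEmbOf τ G θ) : LGraph τ := ⟨G, θ, h⟩

instance : MeasurableSpace FGraph := ⊤
instance (τ : FGraph) : MeasurableSpace (LGraph τ) := ⊤
noncomputable instance (τ : FGraph) :
    MeasurableSpace {ψ : LGraph τ → ℝ // IsLimitLGraph ψ} := borel _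


namespace FGraph

theorem Iso.symm {G H : FGraph} : Iso G H → Iso H G := by
  rintro ⟨f, hf, hadj⟩
  refine ⟨Function.invFunOn f G.verts, hf.symm hf.invOn_invFunOn.symm, fun a ha b hb => ?_⟩
  have hmaps := hf.surjOn.mapsTo_invFunOn
  rw [hadj _ (hmaps ha) _ (hmaps hb), hf.invOn_invFunOn.2 ha, hf.invOn_invFunOn.2 hb]

theorem Iso.trans {G H K : FGraph} : Iso G H → Iso H K → Iso G K := by
  rintro ⟨f, hf, hfadj⟩ ⟨g, hg, hgadj⟩
  refine ⟨g ∘ f, hg.comp hf, fun a ha b hb => ?_⟩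
  rw [hfadj a ha b hb, hgadj _ (hf.mapsTo ha) _ (hf.mapsTo hb)]
  rfl

theorem Iso.card_verts_eq {G H : FGraph} : Iso G H → G.verts.card = H.verts.card := by
  rintro ⟨f, hf, -⟩
  exact Finset.card_nbij f hf.mapsTo hf.injOn hf.surjOn

theorem iso_induce_verts (G : FGraph) : Iso G (G.induce G.verts) :=
  ⟨id, Set.bijOn_id _, fun _ ha _ hb => ⟨fun h => ⟨ha, hb, h⟩, fun h => h.2.2⟩⟩

/-- An isomorphism `G ≅ G'` sends induced copies of `H` in `G` injectively to induced copies
of `H` in `G'`. -/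
theorem Iso.card_copies_le {G G' : FGraph} (h : Iso G G') (H : FGraph) (n : ℕ)
    [DecidablePred fun U => Iso H (G.induce U)] [DecidablePred fun U => Iso H (G'.induce U)] :
    ((G.verts.powersetCard n).filter fun U => Iso H (G.induce U)).card ≤
      ((G'.verts.powersetCard n).filter fun U => Iso H (G'.induce U)).card := by
  obtain ⟨f, hf, hadj⟩ := h
  refine Finset.card_le_card_of_injOn (Finset.image f) ?_ ?_
  · intro U hU
    simp only [Finset.coe_filter, Set.mem_ofPred_eq, Finset.mem_powersetCard] at hU ⊢
    obtain ⟨⟨hUG, hcard⟩, hiso⟩ := hU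
    have hinj : Set.InjOn f U := hf.injOn.mono (Finset.coe_subset.mpr hUG)
    refine ⟨⟨Finset.image_subset_iff.mpr fun a ha => hf.mapsTo (hUG ha), ?_⟩, hiso.trans ?_⟩
    · rw [Finset.card_image_of_injOn hinj, hcard]
    · refine ⟨f, ?_, fun a (ha : a ∈ U) b (hb : b ∈ U) => ?_⟩
      · simpa [induce] using hinj.bijOn_image
      · simp only [induce, ha, hb, true_and, Finset.mem_image_of_mem f, hadj a (hUG ha) b (hUG hb)]
  · intro U hU V hV hUV
    simp only [Finset.coe_filter, Set.mem_ofPred_eq, Finset.mem_powersetCard] at hU hV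
    refine Finset.coe_injective ((hf.injOn.image_eq_image_iff
      (Finset.coe_subset.mpr hU.1.1) (Finset.coe_subset.mpr hV.1.1)).mp ?_)
    exact_mod_cast hUV

theorem Iso.density_eq {G G' : FGraph} (h : Iso G G') (H : FGraph) :
    density H G = density H G' := by
  classical
  unfold density
  rw [Finset.card_powersetCard, Finset.card_powersetCard, h.card_verts_eq,
    le_antisymm (h.card_copies_le H _) (h.symm.card_copies_le H _)]

theorem exists_iso_induce_of_density_ne_zero {H G : FGraph} (h : density H G ≠ 0) :
    ∃ U ⊆ G.verts, Iso H (G.induce U) := by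
  classical
  unfold density at h
  obtain ⟨U, hU⟩ := Finset.card_ne_zero.mp (Nat.cast_ne_zero.mp (div_ne_zero_iff.mp h).1)
  rw [Finset.mem_filter, Finset.mem_powersetCard] at hU
  exact ⟨U, hU.1.1, hU.2⟩

theorem density_self (G : FGraph) : density G G = 1 := by
  classical
  simp [density, Finset.powersetCard_self, Finset.filter_singleton, iso_induce_verts G]

end FGraph

theorem density_injective_up_to_iso (G G' : FGraph) :
    (∀ H : FGraph, FGraph.density H G = FGraph.density H G') ↔ FGraph.Iso G G' := by
  refine ⟨fun h => ?_, fun h H => h.density_eq H⟩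
  obtain ⟨U, hU, hGU⟩ := FGraph.exists_iso_induce_of_density_ne_zero (H := G) (G := G')
    (by rw [← h, FGraph.density_self]; exact one_ne_zero)
  obtain ⟨V, hV, hGV⟩ := FGraph.exists_iso_induce_of_density_ne_zero (H := G') (G := G)
    (by rw [h, FGraph.density_self]; exact one_ne_zero)
  have hle : G'.verts.card ≤ U.card :=
    (hGV.card_verts_eq.trans_le (Finset.card_le_card hV)).trans_eq hGU.card_verts_eq
  rw [Finset.eq_of_subset_of_card_le hU hle] at hGU
  exact hGU.trans G'.iso_induce_verts.symm
end

section
/- Let V ⊆ ℕ be a finite set, let 𝓗 be a complete set of graphs on V, and let H_1, H_2 be graphs with v(H_1) + v(H_2) ≤ |V|. For each H ∈ 𝓗, let r_H be the probability that, for uniformly random disjoint subsets U_1, U_2 of V(H) of sizes v(H_1) and v(H_2) respectively, H[U_1] ≅ H_1 and H[U_2] ≅ H_2. Then for every limiting graph φ, φ(H_1)·φ(H_2) = Σ_{H ∈ 𝓗} r_H·φ(H). -/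
open Filter Topology MeasureTheory

namespace FGraph

theorem induce_induce (G : FGraph) {U W : Finset ℕ} (h : U ⊆ W) :
    (G.induce W).induce U = G.induce U := by
  simp only [induce, FGraph.mk.injEq, true_and]
  funext a b
  exact propext ⟨fun ⟨ha, hb, _, _, hab⟩ => ⟨ha, hb, hab⟩,
    fun ⟨ha, hb, hab⟩ => ⟨ha, hb, h ha, h hb, hab⟩⟩

theorem iso_induce_image {G G' : FGraph} {f : ℕ → ℕ} (hf : Set.InjOn f ↑G.verts)
    (hadj : ∀ a ∈ G.verts, ∀ b ∈ G.verts, (G.Adj a b ↔ G'.Adj (f a) (f b)))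
    {U : Finset ℕ} (hU : U ⊆ G.verts) : Iso (G.induce U) (G'.induce (U.image f)) := by
  refine ⟨f, ?_, fun a ha b hb => ?_⟩
  · simpa [induce] using (hf.mono (Finset.coe_subset.2 hU)).bijOn_image
  · have ha' : a ∈ U := ha
    have hb' : b ∈ U := hb
    simp only [induce, ha', hb', Finset.mem_image_of_mem f ha', Finset.mem_image_of_mem f hb',
      true_and]
    exact hadj a (hU ha) b (hU hb)

/-- Every graph is isomorphic to one on any prescribed vertex set of the right size. -/
theorem exists_iso_of_card_eq (G : FGraph) {V : Finset ℕ} (h : V.card = G.verts.card) :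
    ∃ K : FGraph, K.verts = V ∧ Iso K G := by
  obtain ⟨f, hf⟩ := V.finite_toSet.exists_bijOn_of_encard_eq (t := (↑G.verts : Set ℕ))
    (by simpa only [Set.encard_coe_eq_coe_finsetCard] using congrArg Nat.cast h)
  refine ⟨⟨V, fun a b => a ∈ V ∧ b ∈ V ∧ G.Adj (f a) (f b),
    fun a b ⟨ha, hb, hab⟩ => ⟨hb, ha, G.symm _ _ hab⟩,
    fun a ⟨_, _, ha⟩ => G.irrefl _ ha, fun a b ⟨ha, hb, _⟩ => ⟨ha, hb⟩⟩, rfl, f, hf, ?_⟩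
  intro a ha b hb
  exact ⟨fun hab => hab.2.2, fun hab => ⟨ha, hb, hab⟩⟩

end FGraph

open Classical in
/-- The pairs of disjoint subsets of `S` of sizes `k` and `l`. -/
noncomputable def disjointPairs (S : Finset ℕ) (k l : ℕ) : Finset (Finset ℕ × Finset ℕ) :=
  (S.powersetCard k ×ˢ S.powersetCard l).filter fun p => Disjoint p.1 p.2

theorem mem_disjointPairs {S : Finset ℕ} {k l : ℕ} {p : Finset ℕ × Finset ℕ} :
    p ∈ disjointPairs S k l ↔
      (p.1 ⊆ S ∧ p.1.card = k) ∧ (p.2 ⊆ S ∧ p.2.card = l) ∧ Disjoint p.1 p.2 := by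
  simp [disjointPairs, Finset.mem_powersetCard, and_assoc]

theorem card_disjointPairs (S : Finset ℕ) (k l : ℕ) :
    (disjointPairs S k l).card = S.card.choose k * (S.card - k).choose l := by
  classical
  have key : ∀ U ∈ S.powersetCard k,
      ((S.powersetCard l).filter fun W => Disjoint U W).card = (S.card - k).choose l := by
    intro U hU
    rw [Finset.mem_powersetCard] at hU
    rw [← hU.2, ← Finset.card_sdiff_of_subset hU.1, ← Finset.card_powersetCard]
    congr 1
    ext W
    simp only [Finset.mem_filter, Finset.mem_powersetCard, Finset.subset_sdiff, disjoint_comm]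
    tauto
  rw [disjointPairs, Finset.card_filter, Finset.sum_product, ← Finset.card_powersetCard k S,
    ← smul_eq_mul, ← Finset.sum_const]
  refine Finset.sum_congr rfl fun U hU => ?_
  rw [← key U hU, Finset.card_filter]

/-- Double counting of the triples consisting of an `m`-subset `W` of `S` and a disjoint pair of
subsets of `W`. -/
theorem card_filter_disjointPairs_mul_choose (S : Finset ℕ) {k l m : ℕ} (h : k + l ≤ m)
    (Q : Finset ℕ × Finset ℕ → Prop) [DecidablePred Q] :
    ((disjointPairs S k l).filter Q).card * (S.card - (k + l)).choose (m - (k + l)) =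
      ∑ W ∈ S.powersetCard m, ((disjointPairs W k l).filter Q).card := by
  classical
  have hcount := Finset.sum_card_bipartiteAbove_eq_sum_card_bipartiteBelow
    (fun (p : Finset ℕ × Finset ℕ) (W : Finset ℕ) => p.1 ∪ p.2 ⊆ W)
    (s := (disjointPairs S k l).filter Q) (t := S.powersetCard m)
  rw [← smul_eq_mul, ← Finset.sum_const]
  convert hcount using 1
  · refine Finset.sum_congr rfl fun p hp => ?_
    obtain ⟨⟨h1, h1c⟩, ⟨h2, h2c⟩, hd⟩ := mem_disjointPairs.1 (Finset.mem_filter.1 hp).1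
    have hc : (p.1 ∪ p.2).card = k + l := by rw [Finset.card_union_of_disjoint hd, h1c, h2c]
    rw [← hc, ← Finset.card_filter_powersetCard_subset _ _ _ (Finset.union_subset h1 h2)
      (hc.trans_le h), Finset.bipartiteAbove]
  · refine Finset.sum_congr rfl fun W hW => congrArg Finset.card ?_
    have hWS := (Finset.mem_powersetCard.1 hW).1
    ext p
    simp only [Finset.mem_filter, Finset.mem_bipartiteBelow, mem_disjointPairs,
      Finset.union_subset_iff]
    constructor
    · rintro ⟨⟨⟨h1, h1c⟩, ⟨h2, h2c⟩, hd⟩, hQ⟩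
      exact ⟨⟨⟨⟨h1.trans hWS, h1c⟩, ⟨h2.trans hWS, h2c⟩, hd⟩, hQ⟩, h1, h2⟩
    · rintro ⟨⟨⟨⟨_, h1c⟩, ⟨_, h2c⟩, hd⟩, hQ⟩, h1, h2⟩
      exact ⟨⟨⟨h1, h1c⟩, ⟨h2, h2c⟩, hd⟩, hQ⟩

open Classical in
/-- The disjoint pairs of vertex sets of `G` inducing copies of `H1` and `H2`. -/
noncomputable def inducedPairs (G H1 H2 : FGraph) : Finset (Finset ℕ × Finset ℕ) :=
  (disjointPairs G.verts H1.verts.card H2.verts.card).filter fun p =>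
    FGraph.Iso H1 (G.induce p.1) ∧ FGraph.Iso H2 (G.induce p.2)

theorem rval_eq_div (G H1 H2 : FGraph) :
    rval G H1 H2 = ((inducedPairs G H1 H2).card : ℝ) /
      (disjointPairs G.verts H1.verts.card H2.verts.card).card :=
  rfl

theorem card_inducedPairs_le_of_iso {G G' : FGraph} (H1 H2 : FGraph) (h : FGraph.Iso G G') :
    (inducedPairs G H1 H2).card ≤ (inducedPairs G' H1 H2).card := by
  classical
  obtain ⟨f, hf, hadj⟩ := h
  have hsub : ∀ {U : Finset ℕ}, U ⊆ G.verts → U.image f ⊆ G'.verts := fun hU =>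
    Finset.image_subset_iff.2 fun x hx => hf.mapsTo (hU hx)
  have hcard : ∀ {U : Finset ℕ}, U ⊆ G.verts → (U.image f).card = U.card := fun hU =>
    Finset.card_image_of_injOn (hf.injOn.mono (Finset.coe_subset.2 hU))
  have hinj : ∀ {U U' : Finset ℕ}, U ⊆ G.verts → U' ⊆ G.verts → U.image f = U'.image f →
      U = U' := by
    intro U U' hU hU' hUU'
    have := congrArg ((↑) : Finset ℕ → Set ℕ) hUU'
    simp only [Finset.coe_image] at this
    exact Finset.coe_injective ((hf.injOn.image_eq_image_iff hU hU').1 this)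
  refine Finset.card_le_card_of_injOn (fun p => (p.1.image f, p.2.image f)) ?_ ?_
  · intro p hp
    obtain ⟨hp, hi1, hi2⟩ := Finset.mem_filter.1 hp
    obtain ⟨⟨h1, h1c⟩, ⟨h2, h2c⟩, hd⟩ := mem_disjointPairs.1 hp
    refine Finset.mem_filter.2 ⟨mem_disjointPairs.2 ⟨⟨hsub h1, (hcard h1).trans h1c⟩,
      ⟨hsub h2, (hcard h2).trans h2c⟩, ?_⟩,
      hi1.trans (FGraph.iso_induce_image hf.injOn hadj h1),
      hi2.trans (FGraph.iso_induce_image hf.injOn hadj h2)⟩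
    rw [Finset.disjoint_left] at hd ⊢
    intro x hx hx'
    obtain ⟨a, ha, rfl⟩ := Finset.mem_image.1 hx
    obtain ⟨b, hb, hab⟩ := Finset.mem_image.1 hx'
    exact hd ha (hf.injOn (h2 hb) (h1 ha) hab ▸ hb)
  · intro p hp q hq hpq
    obtain ⟨⟨h1, _⟩, ⟨h2, _⟩, _⟩ := mem_disjointPairs.1 (Finset.mem_filter.1 hp).1
    obtain ⟨⟨h3, _⟩, ⟨h4, _⟩, _⟩ := mem_disjointPairs.1 (Finset.mem_filter.1 hq).1
    exact Prod.ext (hinj h1 h3 (congrArg Prod.fst hpq)) (hinj h2 h4 (congrArg Prod.snd hpq))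

theorem card_inducedPairs_eq_of_iso {G G' : FGraph} (H1 H2 : FGraph) (h : FGraph.Iso G G') :
    (inducedPairs G H1 H2).card = (inducedPairs G' H1 H2).card :=
  (card_inducedPairs_le_of_iso H1 H2 h).antisymm (card_inducedPairs_le_of_iso H1 H2 h.symm)

theorem CompleteOn.existsUnique_iso {V : Finset ℕ} {𝓗 : Finset FGraph} (hc : CompleteOn V 𝓗)
    {G : FGraph} (hG : G.verts.card = V.card) : ∃! H, H ∈ 𝓗 ∧ FGraph.Iso H G := by
  obtain ⟨K, hKV, hKG⟩ := G.exists_iso_of_card_eq hG.symm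
  obtain ⟨H, ⟨hH, hKH⟩, huniq⟩ := hc.2 K hKV
  exact ⟨H, ⟨hH, hKH.symm.trans hKG⟩, fun H' ⟨hH', hi⟩ => huniq H' ⟨hH', hKG.trans hi.symm⟩⟩

open Classical in
theorem sum_card_filter_disjointPairs_eq {V : Finset ℕ} {𝓗 : Finset FGraph}
    (hc : CompleteOn V 𝓗) (G H1 H2 : FGraph) :
    ∑ W ∈ G.verts.powersetCard V.card,
        ((disjointPairs W H1.verts.card H2.verts.card).filter fun p =>
          FGraph.Iso H1 (G.induce p.1) ∧ FGraph.Iso H2 (G.induce p.2)).card =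
      ∑ H ∈ 𝓗, ((G.verts.powersetCard V.card).filter
        fun W => FGraph.Iso H (G.induce W)).card * (inducedPairs H H1 H2).card := by
  have hW : ∀ W ∈ G.verts.powersetCard V.card,
      ((disjointPairs W H1.verts.card H2.verts.card).filter fun p =>
          FGraph.Iso H1 (G.induce p.1) ∧ FGraph.Iso H2 (G.induce p.2)).card =
        ∑ H ∈ 𝓗, if FGraph.Iso H (G.induce W) then (inducedPairs H H1 H2).card else 0 := by
    intro W hW
    obtain ⟨H, ⟨hH, hi⟩, huniq⟩ :=
      hc.existsUnique_iso (G := G.induce W) (Finset.mem_powersetCard.1 hW).2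
    rw [Finset.sum_eq_single_of_mem H hH fun H' hH' hne =>
      if_neg fun hi' => hne (huniq H' ⟨hH', hi'⟩), if_pos hi, card_inducedPairs_eq_of_iso H1 H2 hi]
    refine congrArg Finset.card (Finset.filter_congr fun p hp => ?_)
    obtain ⟨⟨h1, _⟩, ⟨h2, _⟩, _⟩ := mem_disjointPairs.1 hp
    rw [G.induce_induce h1, G.induce_induce h2]
  rw [Finset.sum_congr rfl hW, Finset.sum_comm]
  refine Finset.sum_congr rfl fun H _ => ?_
  rw [← Finset.sum_filter, Finset.sum_const, smul_eq_mul]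

theorem card_disjointPairs_pos {S : Finset ℕ} {k l : ℕ} (h : k + l ≤ S.card) :
    0 < (disjointPairs S k l).card := by
  rw [card_disjointPairs]
  exact Nat.mul_pos (Nat.choose_pos (by lia)) (Nat.choose_pos (by lia))

theorem rval_eq_sum {V : Finset ℕ} {𝓗 : Finset FGraph} (hc : CompleteOn V 𝓗)
    {G H1 H2 : FGraph} (hsz : H1.verts.card + H2.verts.card ≤ V.card)
    (hG : V.card ≤ G.verts.card) :
    rval G H1 H2 = ∑ H ∈ 𝓗, rval H H1 H2 * FGraph.density H G := by
  classical
  have hgood : (inducedPairs G H1 H2).card *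
      (G.verts.card - (H1.verts.card + H2.verts.card)).choose
        (V.card - (H1.verts.card + H2.verts.card)) =
      ∑ H ∈ 𝓗, ((G.verts.powersetCard V.card).filter
        fun W => FGraph.Iso H (G.induce W)).card * (inducedPairs H H1 H2).card := by
    rw [inducedPairs]
    convert (card_filter_disjointPairs_mul_choose G.verts hsz _).trans ?_
    convert sum_card_filter_disjointPairs_eq hc G H1 H2
  have hall := card_filter_disjointPairs_mul_choose G.verts hsz fun _ => True
  have hconst : ∀ W ∈ G.verts.powersetCard V.card,
      ((disjointPairs W H1.verts.card H2.verts.card).filter fun _ => True).card =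
        (disjointPairs V H1.verts.card H2.verts.card).card := fun W hW => by
    rw [Finset.filter_true, card_disjointPairs, card_disjointPairs,
      (Finset.mem_powersetCard.1 hW).2]
  rw [Finset.sum_congr rfl hconst, Finset.sum_const, smul_eq_mul, Finset.filter_true] at hall
  have hDG := card_disjointPairs_pos (hsz.trans hG)
  have hDV := card_disjointPairs_pos hsz
  have hT : 0 < (G.verts.powersetCard V.card).card := by
    rw [Finset.card_powersetCard]
    exact Nat.choose_pos hG
  have hterm : ∀ H ∈ 𝓗, rval H H1 H2 * FGraph.density H G =
      ((((G.verts.powersetCard V.card).filter fun W => FGraph.Iso H (G.induce W)).card *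
        (inducedPairs H H1 H2).card : ℕ) : ℝ) /
      ((disjointPairs V H1.verts.card H2.verts.card).card *
        (G.verts.powersetCard V.card).card) := fun H hH => by
    rw [rval_eq_div, FGraph.density, hc.1 H hH, div_mul_div_comm, Nat.cast_mul, mul_comm
      ((inducedPairs H H1 H2).card : ℝ)]
  rw [Finset.sum_congr rfl hterm, ← Finset.sum_div, ← Nat.cast_sum, ← hgood, rval_eq_div,
    div_eq_div_iff (by positivity) (by positivity)]
  norm_cast
  rw [mul_comm (disjointPairs V _ _).card, ← hall]
  ring

theorem tendsto_choose_sub_div_choose (k l : ℕ) :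
    Tendsto (fun n : ℕ => ((n - k).choose l : ℝ) / (n.choose l : ℝ)) atTop (𝓝 1) := by
  have h := ((isEquivalent_choose l).comp_tendsto (tendsto_sub_atTop_nat k)).div
    (isEquivalent_choose l)
  refine h.symm.tendsto_nhds ?_
  have hlim : Tendsto (fun n : ℕ => (1 - (k : ℝ) / n) ^ l) atTop (𝓝 1) := by
    simpa using ((tendsto_const_div_atTop_nhds_zero_nat (k : ℝ)).const_sub 1).pow l
  refine hlim.congr' ?_
  filter_upwards [eventually_ge_atTop k, eventually_gt_atTop 0] with n hkn hn
  have hn' : (n : ℝ) ≠ 0 := by exact_mod_cast hn.ne'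
  have hfac : (l.factorial : ℝ) ≠ 0 := by exact_mod_cast l.factorial_ne_zero
  simp only [Pi.div_apply, Function.comp_apply, Nat.cast_sub hkn]
  rw [div_div_div_cancel_right₀ hfac, ← div_pow, sub_div, div_self hn']

theorem abs_density_mul_density_sub_rval_le {G H1 H2 : FGraph}
    (hG : H1.verts.card + H2.verts.card ≤ G.verts.card) :
    |FGraph.density H1 G * FGraph.density H2 G - rval G H1 H2| ≤
      1 - ((G.verts.card - H1.verts.card).choose H2.verts.card : ℝ) /
        (G.verts.card.choose H2.verts.card : ℝ) := by
  classical
  set k := H1.verts.card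
  set l := H2.verts.card
  set T := G.verts.powersetCard k ×ˢ G.verts.powersetCard l with hT
  set P := T.filter fun p => FGraph.Iso H1 (G.induce p.1) ∧ FGraph.Iso H2 (G.induce p.2) with hP
  set D := disjointPairs G.verts k l with hD
  set A := inducedPairs G H1 H2
  have hDT : D ⊆ T := Finset.filter_subset _ _
  have hAD : A ⊆ D := Finset.filter_subset _ _
  have hAP : A ⊆ P := fun p hp =>
    Finset.mem_filter.2 ⟨hDT (hAD hp), (Finset.mem_filter.1 hp).2⟩
  have hPA : P \ A ⊆ T \ D := fun p hp => by
    obtain ⟨hpP, hpA⟩ := Finset.mem_sdiff.1 hp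
    exact Finset.mem_sdiff.2 ⟨(Finset.mem_filter.1 hpP).1, fun hpD =>
      hpA (Finset.mem_filter.2 ⟨hpD, (Finset.mem_filter.1 hpP).2⟩)⟩
  have hPle : (P.card : ℝ) + D.card ≤ A.card + T.card := by
    have := Finset.card_le_card hPA
    rw [Finset.card_sdiff_of_subset hAP, Finset.card_sdiff_of_subset hDT] at this
    have := Finset.card_le_card hDT
    exact_mod_cast (by lia : P.card + D.card ≤ A.card + T.card)
  have hAPc : (A.card : ℝ) ≤ P.card := by exact_mod_cast Finset.card_le_card hAP
  have hADc : (A.card : ℝ) ≤ D.card := by exact_mod_cast Finset.card_le_card hAD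
  have hDTc : (D.card : ℝ) ≤ T.card := by exact_mod_cast Finset.card_le_card hDT
  have hDpos : (0 : ℝ) < D.card := by exact_mod_cast card_disjointPairs_pos hG
  have hTpos : (0 : ℝ) < T.card := hDpos.trans_le hDTc
  have hdens : FGraph.density H1 G * FGraph.density H2 G = P.card / T.card := by
    have hPc : P = (G.verts.powersetCard k).filter (fun U => FGraph.Iso H1 (G.induce U)) ×ˢ
        (G.verts.powersetCard l).filter fun U => FGraph.Iso H2 (G.induce U) := by
      ext p
      simp only [hP, hT, Finset.mem_filter, Finset.mem_product]
      tauto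
    rw [FGraph.density, FGraph.density, div_mul_div_comm, hPc, hT, Finset.card_product,
      Finset.card_product, Nat.cast_mul, Nat.cast_mul]
  have hratio : ((G.verts.card - k).choose l : ℝ) / (G.verts.card.choose l : ℝ) =
      D.card / T.card := by
    have : (G.verts.card.choose k : ℝ) ≠ 0 := by
      exact_mod_cast (Nat.choose_pos (by lia)).ne'
    rw [hD, card_disjointPairs, hT, Finset.card_product, Finset.card_powersetCard,
      Finset.card_powersetCard, Nat.cast_mul, Nat.cast_mul, mul_div_mul_left _ _ this]
  rw [hdens, hratio, rval_eq_div, abs_le]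
  have hr : (A.card : ℝ) / D.card - A.card / T.card ≤ 1 - D.card / T.card := by
    have h1 : (A.card : ℝ) / T.card = A.card / D.card * (D.card / T.card) := by field_simp
    have h2 : (A.card : ℝ) / D.card ≤ 1 := (div_le_one hDpos).2 hADc
    have h3 : (D.card : ℝ) / T.card ≤ 1 := (div_le_one hTpos).2 hDTc
    rw [h1]
    nlinarith
  have hl' : (A.card : ℝ) / T.card ≤ P.card / T.card := by gcongr
  have hu : (P.card : ℝ) / T.card + D.card / T.card ≤ A.card / T.card + 1 := by
    rw [← div_self hTpos.ne', ← add_div, ← add_div]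
    gcongr
  have hu' : (A.card : ℝ) / T.card ≤ A.card / D.card := by gcongr
  constructor <;> linarith

theorem IncreasingSeq.tendsto_card {Gs : ℕ → FGraph} (h : IncreasingSeq Gs) :
    Tendsto (fun n => (Gs n).verts.card) atTop atTop :=
  (strictMono_nat_of_lt_succ h).tendsto_atTop

theorem limit_mul_decomposition (V : Finset ℕ) (𝓗 : Finset FGraph) (hc : CompleteOn V 𝓗)
    (H1 H2 : FGraph) (hsz : H1.verts.card + H2.verts.card ≤ V.card)
    (φ : FGraph → ℝ) (hφ : IsLimitGraph φ) :
    φ H1 * φ H2 = ∑ H ∈ 𝓗, rval H H1 H2 * φ H := by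
  obtain ⟨Gs, hinc, hlim⟩ := hφ
  have hcard := hinc.tendsto_card
  have hlarge := hcard.eventually_ge_atTop V.card
  have hsum : Tendsto (fun n => rval (Gs n) H1 H2) atTop
      (𝓝 (∑ H ∈ 𝓗, rval H H1 H2 * φ H)) :=
    (tendsto_finsetSum 𝓗 fun H _ => (hlim H).const_mul (rval H H1 H2)).congr'
      (hlarge.mono fun n hn => (rval_eq_sum hc hsz hn).symm)
  have herr : Tendsto (fun n => FGraph.density H1 (Gs n) * FGraph.density H2 (Gs n) -
      rval (Gs n) H1 H2) atTop (𝓝 0) := by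
    have hb := ((tendsto_choose_sub_div_choose H1.verts.card H2.verts.card).comp hcard).const_sub 1
    rw [sub_self] at hb
    exact squeeze_zero_norm'
      (hlarge.mono fun n hn => abs_density_mul_density_sub_rval_le (hsz.trans hn)) hb
  exact sub_eq_zero.1 (tendsto_nhds_unique (((hlim H1).mul (hlim H2)).sub hsum) herr)
end

section
/- For every limiting graph φ, φ(I_3) − (1/3)·φ(E_3) − (1/3)·φ(P_3) + φ(K_3) ≥ 0, where I_3, E_3, P_3, K_3 are respectively the edgeless graph, the graph with exactly one edge, the path with two edges, and the complete graph, each on vertex set [3]. -/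
open Filter Topology MeasureTheory

open Classical in
/-- The `±1` edge sign of a pair of vertices, with value `0` on the diagonal. -/
noncomputable def FGraph.sign (G : FGraph) (a b : ℕ) : ℝ :=
  if a = b then 0 else if G.Adj a b then 1 else -1

/-- The signed cherry weight centred at `v`, vanishing unless `v, x, y` are distinct. -/
noncomputable def FGraph.cherry (G : FGraph) (v x y : ℕ) : ℝ :=
  if x = y then 0 else G.sign v x * G.sign v y

open Classical in
/-- The Mantel combination of the induced subgraph indicators on a vertex set `U`. -/
noncomputable def FGraph.mantelIndicator (G : FGraph) (U : Finset ℕ) : ℝ :=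
  (if FGraph.Iso (FGraph.edgeless 3) (G.induce U) then 1 else 0)
    - (1 / 3) * (if FGraph.Iso FGraph.oneEdge3 (G.induce U) then 1 else 0)
    - (1 / 3) * (if FGraph.Iso FGraph.path3 (G.induce U) then 1 else 0)
    + (if FGraph.Iso (FGraph.completeG 3) (G.induce U) then 1 else 0)

namespace FGraph

lemma Iso.exists_triple {H G : FGraph} {U : Finset ℕ} (hV : H.verts = Finset.Icc 1 3)
    (h : Iso H (G.induce U)) :
    ∃ x ∈ U, ∃ y ∈ U, ∃ z ∈ U, x ≠ y ∧ x ≠ z ∧ y ≠ z ∧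
      (H.Adj 1 2 ↔ G.Adj x y) ∧ (H.Adj 1 3 ↔ G.Adj x z) ∧ (H.Adj 2 3 ↔ G.Adj y z) := by
  obtain ⟨f, hf, hadj⟩ := h
  have h1 : 1 ∈ H.verts := by simp [hV]
  have h2 : 2 ∈ H.verts := by simp [hV]
  have h3 : 3 ∈ H.verts := by simp [hV]
  have m1 : f 1 ∈ U := hf.mapsTo h1
  have m2 : f 2 ∈ U := hf.mapsTo h2
  have m3 : f 3 ∈ U := hf.mapsTo h3
  refine ⟨f 1, m1, f 2, m2, f 3, m3, fun e => ?_, fun e => ?_, fun e => ?_, ?_, ?_, ?_⟩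
  · exact absurd (hf.injOn h1 h2 e) (by norm_num)
  · exact absurd (hf.injOn h1 h3 e) (by norm_num)
  · exact absurd (hf.injOn h2 h3 e) (by norm_num)
  · simpa [induce, m1, m2] using hadj 1 h1 2 h2
  · simpa [induce, m1, m3] using hadj 1 h1 3 h3
  · simpa [induce, m2, m3] using hadj 2 h2 3 h3

lemma iso_induce_triple {H G : FGraph} {a b c : ℕ} (hV : H.verts = Finset.Icc 1 3)
    (hab : a ≠ b) (hac : a ≠ c) (hbc : b ≠ c)
    (h12 : H.Adj 1 2 ↔ G.Adj a b) (h13 : H.Adj 1 3 ↔ G.Adj a c)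
    (h23 : H.Adj 2 3 ↔ G.Adj b c) : Iso H (G.induce {a, b, c}) := by
  have hI : H.verts = {1, 2, 3} := by rw [hV]; rfl
  have hH (x y : ℕ) : H.Adj x y ↔ H.Adj y x := ⟨H.symm x y, H.symm y x⟩
  have hG (x y : ℕ) : G.Adj x y ↔ G.Adj y x := ⟨G.symm x y, G.symm y x⟩
  refine ⟨fun i => if i = 1 then a else if i = 2 then b else c, ⟨?_, ?_, ?_⟩, ?_⟩
  · intro i hi
    simp only [induce, Finset.coe_insert, Finset.coe_singleton]
    split_ifs <;> simp
  · intro i hi j hj hij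
    simp only [hI, Finset.coe_insert, Finset.coe_singleton, Set.mem_insert_iff,
      Set.mem_singleton_iff] at hi hj
    rcases hi with rfl | rfl | rfl <;> rcases hj with rfl | rfl | rfl <;> simp_all
  · intro y hy
    simp only [induce, Finset.coe_insert, Finset.coe_singleton, Set.mem_insert_iff,
      Set.mem_singleton_iff] at hy
    rcases hy with rfl | rfl | rfl
    · exact ⟨1, by simp [hI], by simp⟩
    · exact ⟨2, by simp [hI], by simp⟩
    · exact ⟨3, by simp [hI], by simp⟩
  · intro i hi j hj
    simp only [hI, Finset.mem_insert, Finset.mem_singleton] at hi hj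
    rcases hi with rfl | rfl | rfl <;> rcases hj with rfl | rfl | rfl <;>
      simp [induce, H.irrefl, G.irrefl, h12, h13, h23, hH 2 1, hH 3 1, hH 3 2,
        hG b a, hG c a, hG c b]

lemma sum_cherry_le_mantelIndicator (G : FGraph) {U : Finset ℕ} (hU : U.card = 3) :
    ∑ v ∈ U, ∑ x ∈ U, ∑ y ∈ U, G.cherry v x y ≤ 6 * G.mantelIndicator U := by
  obtain ⟨a, b, c, hab, hac, hbc, rfl⟩ := Finset.card_eq_three.mp hU
  have hG (x y : ℕ) : G.Adj x y ↔ G.Adj y x := ⟨G.symm x y, G.symm y x⟩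
  have hE : Iso oneEdge3 (G.induce {a, b, c}) →
      (G.Adj a b ∧ ¬ G.Adj a c ∧ ¬ G.Adj b c) ∨ (¬ G.Adj a b ∧ G.Adj a c ∧ ¬ G.Adj b c) ∨
        (¬ G.Adj a b ∧ ¬ G.Adj a c ∧ G.Adj b c) := by
    intro h
    obtain ⟨x, hx, y, hy, z, hz, hxy, hxz, hyz, e1, e2, e3⟩ := h.exists_triple rfl
    simp [oneEdge3, ofRel] at e1 e2 e3
    simp only [Finset.mem_insert, Finset.mem_singleton] at hx hy hz
    rcases hx with rfl | rfl | rfl <;> rcases hy with rfl | rfl | rfl <;>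
      rcases hz with rfl | rfl | rfl <;> grind
  have hP : Iso path3 (G.induce {a, b, c}) →
      (¬ G.Adj a b ∧ G.Adj a c ∧ G.Adj b c) ∨ (G.Adj a b ∧ ¬ G.Adj a c ∧ G.Adj b c) ∨
        (G.Adj a b ∧ G.Adj a c ∧ ¬ G.Adj b c) := by
    intro h
    obtain ⟨x, hx, y, hy, z, hz, hxy, hxz, hyz, e1, e2, e3⟩ := h.exists_triple rfl
    simp [path3, ofRel] at e1 e2 e3
    simp only [Finset.mem_insert, Finset.mem_singleton] at hx hy hz
    rcases hx with rfl | rfl | rfl <;> rcases hy with rfl | rfl | rfl <;>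
      rcases hz with rfl | rfl | rfl <;> grind
  have hI : ¬ G.Adj a b → ¬ G.Adj a c → ¬ G.Adj b c →
      Iso (edgeless 3) (G.induce {a, b, c}) := fun h1 h2 h3 =>
    iso_induce_triple rfl hab hac hbc (by simp [edgeless, ofRel, h1])
      (by simp [edgeless, ofRel, h2]) (by simp [edgeless, ofRel, h3])
  have hK : G.Adj a b → G.Adj a c → G.Adj b c →
      Iso (completeG 3) (G.induce {a, b, c}) := fun h1 h2 h3 =>
    iso_induce_triple rfl hab hac hbc (by simp [completeG, ofRel, h1])
      (by simp [completeG, ofRel, h2]) (by simp [completeG, ofRel, h3])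
  have hsum : ∑ v ∈ ({a, b, c} : Finset ℕ), ∑ x ∈ ({a, b, c} : Finset ℕ),
      ∑ y ∈ ({a, b, c} : Finset ℕ), G.cherry v x y =
      2 * (G.sign a b * G.sign a c + G.sign a b * G.sign b c + G.sign a c * G.sign b c) := by
    have hs (x y : ℕ) : G.sign x y = G.sign y x := by
      rcases eq_or_ne x y with rfl | h
      · rfl
      · simp only [sign, h, h.symm, if_false]
        split_ifs with hx hy hy
        exacts [rfl, absurd ((hG x y).mp hx) hy, absurd ((hG x y).mpr hy) hx, rfl]
    have h0 (x : ℕ) : G.sign x x = 0 := by simp [sign]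
    simp [Finset.sum_insert, hab, hac, hbc, cherry, hab.symm, hac.symm, hbc.symm, h0,
      hs b a, hs c a, hs c b]
    ring
  rw [hsum]
  simp only [sign, hab, hac, hbc, if_false, mantelIndicator]
  by_cases h1 : G.Adj a b <;> by_cases h2 : G.Adj a c <;> by_cases h3 : G.Adj b c <;>
    simp only [h1, h2, h3, not_true, not_false_eq_true, and_true, and_false, or_false,
      or_true, true_implies, false_implies, imp_false, if_true, if_false, and_self, or_self,
      implies_true] at hE hP hI hK ⊢ <;>
    simp only [hE, hP, hI, hK, if_true, if_false] <;> split_ifs <;> norm_num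

lemma cherry_eq_zero (G : FGraph) {v x y : ℕ} (h : v = x ∨ v = y ∨ x = y) :
    G.cherry v x y = 0 := by
  rcases h with rfl | rfl | rfl <;> simp [cherry, sign]

lemma sum_powersetCard_cherry (G : FGraph) (V : Finset ℕ) :
    ∑ U ∈ V.powersetCard 3, ∑ v ∈ U, ∑ x ∈ U, ∑ y ∈ U, G.cherry v x y =
      ∑ v ∈ V, ∑ x ∈ V, ∑ y ∈ V, G.cherry v x y := by
  simp_rw [← Finset.sum_product']
  rw [Finset.sum_sigma']
  refine Finset.sum_bij_ne_zero (fun p _ _ => p.2) ?_ ?_ ?_ ?_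
  · rintro ⟨U, v, x, y⟩ hp -
    simp only [Finset.mem_sigma, Finset.mem_powersetCard, Finset.mem_product] at hp ⊢
    exact ⟨hp.1.1 hp.2.1, hp.1.1 hp.2.2.1, hp.1.1 hp.2.2.2⟩
  · rintro ⟨U, v, x, y⟩ hp hne ⟨U', v', x', y'⟩ hp' - heq
    simp only [Finset.mem_sigma, Finset.mem_powersetCard, Finset.mem_product] at hp hp'
    simp only [Prod.mk.injEq] at heq
    obtain ⟨rfl, rfl, rfl⟩ := heq
    have hd : v ≠ x ∧ v ≠ y ∧ x ≠ y := by
      by_contra hcon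
      exact hne (G.cherry_eq_zero (by tauto))
    have hcard : ({v, x, y} : Finset ℕ).card = 3 := Finset.card_eq_three.mpr
      ⟨v, x, y, hd.1, hd.2.1, hd.2.2, rfl⟩
    have key (W : Finset ℕ) (hW : W.card = 3) (hm : v ∈ W ∧ x ∈ W ∧ y ∈ W) :
        ({v, x, y} : Finset ℕ) = W := Finset.eq_of_subset_of_card_le
      (by simp [Finset.insert_subset_iff, hm]) (by rw [hW, hcard])
    have hUU : U = U' := (key U hp.1.2 hp.2).symm.trans (key U' hp'.1.2 hp'.2)
    rw [hUU]
  · rintro ⟨v, x, y⟩ hp hne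
    simp only [Finset.mem_product] at hp
    have hd : v ≠ x ∧ v ≠ y ∧ x ≠ y := by
      by_contra hcon
      exact hne (G.cherry_eq_zero (by tauto))
    refine ⟨⟨{v, x, y}, v, x, y⟩, ?_, hne, rfl⟩
    simp only [Finset.mem_sigma, Finset.mem_powersetCard, Finset.mem_product]
    refine ⟨⟨by simp [Finset.insert_subset_iff, hp], ?_⟩, by simp, by simp, by simp⟩
    exact Finset.card_eq_three.mpr ⟨v, x, y, hd.1, hd.2.1, hd.2.2, rfl⟩
  · intros
    rfl

lemma neg_card_sq_le_sum_cherry (G : FGraph) (V : Finset ℕ) :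
    -(V.card : ℝ) ^ 2 ≤ ∑ v ∈ V, ∑ x ∈ V, ∑ y ∈ V, G.cherry v x y := by
  have key (v : ℕ) : -(V.card : ℝ) ≤ ∑ x ∈ V, ∑ y ∈ V, G.cherry v x y := by
    have hc (x y : ℕ) : G.cherry v x y =
        G.sign v x * G.sign v y - if x = y then G.sign v x ^ 2 else 0 := by
      unfold cherry
      split_ifs with h
      · subst h; ring
      · ring
    have hs (x : ℕ) : G.sign v x ^ 2 ≤ 1 := by
      unfold sign
      split_ifs <;> norm_num
    have hle : ∑ x ∈ V, G.sign v x ^ 2 ≤ V.card := by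
      simpa using Finset.sum_le_sum fun x (_ : x ∈ V) => hs x
    have heq : ∑ x ∈ V, ∑ y ∈ V, G.cherry v x y =
        (∑ x ∈ V, G.sign v x) ^ 2 - ∑ x ∈ V, G.sign v x ^ 2 := by
      simp_rw [hc, Finset.sum_sub_distrib, Finset.sum_ite_eq]
      rw [sq, Finset.sum_mul_sum]
      congr 1
      exact Finset.sum_congr rfl fun x hx => if_pos hx
    rw [heq]
    nlinarith [sq_nonneg (∑ x ∈ V, G.sign v x)]
  calc -(V.card : ℝ) ^ 2 = ∑ v ∈ V, -(V.card : ℝ) := by simp; ring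
    _ ≤ _ := Finset.sum_le_sum fun v _ => key v

lemma density_combination_eq (G : FGraph) :
    density (edgeless 3) G - (1 / 3) * density oneEdge3 G - (1 / 3) * density path3 G +
      density (completeG 3) G =
    (∑ U ∈ G.verts.powersetCard 3, G.mantelIndicator U) / (G.verts.card.choose 3 : ℝ) := by
  have hc (H : FGraph) (hV : H.verts = Finset.Icc 1 3) : H.verts.card = 3 := by simp [hV]
  simp only [density, mantelIndicator, hc (edgeless 3) rfl, hc oneEdge3 rfl, hc path3 rfl,
    hc (completeG 3) rfl, Finset.card_powersetCard, Finset.sum_add_distrib,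
    Finset.sum_sub_distrib, ← Finset.mul_sum, Finset.sum_boole]
  ring

lemma neg_four_div_card_le (G : FGraph) (hG : 4 ≤ G.verts.card) :
    -4 / (G.verts.card : ℝ) ≤
      density (edgeless 3) G - (1 / 3) * density oneEdge3 G - (1 / 3) * density path3 G +
        density (completeG 3) G := by
  rw [density_combination_eq]
  have hsum : ∑ U ∈ G.verts.powersetCard 3, ∑ v ∈ U, ∑ x ∈ U, ∑ y ∈ U, G.cherry v x y ≤
      6 * ∑ U ∈ G.verts.powersetCard 3, G.mantelIndicator U := by
    rw [Finset.mul_sum]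
    exact Finset.sum_le_sum fun U hU =>
      G.sum_cherry_le_mantelIndicator (Finset.mem_powersetCard.mp hU).2
  have hlow := (G.neg_card_sq_le_sum_cherry G.verts).trans
    ((G.sum_powersetCard_cherry G.verts).symm.le.trans hsum)
  generalize ∑ U ∈ G.verts.powersetCard 3, G.mantelIndicator U = S at hlow ⊢
  have hch : (6 : ℝ) * (G.verts.card.choose 3 : ℝ) =
      G.verts.card * (G.verts.card - 1) * (G.verts.card - 2) := by
    obtain ⟨m, hm⟩ := Nat.exists_eq_add_of_le hG
    have h := Nat.descFactorial_eq_factorial_mul_choose G.verts.card 3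
    rw [hm] at h ⊢
    have h' : (4 + m - 2) * ((4 + m - 1) * (4 + m)) = 6 * (4 + m).choose 3 := by
      simpa [Nat.descFactorial, Nat.factorial] using h
    rw [show 4 + m - 2 = m + 2 by omega, show 4 + m - 1 = m + 3 by omega] at h'
    have h'' : ((m : ℝ) + 2) * ((m + 3) * (4 + m)) = 6 * ((4 + m).choose 3 : ℝ) := by
      exact_mod_cast h'
    rw [← h'']
    push_cast
    ring
  have hn : (4 : ℝ) ≤ G.verts.card := by exact_mod_cast hG
  generalize (G.verts.card : ℝ) = n at *
  generalize (G.verts.card.choose 3 : ℝ) = C at *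
  have hC : 0 < C := by
    have : 0 < n * (n - 1) * (n - 2) :=
      mul_pos (mul_pos (by linarith) (by linarith)) (by linarith)
    linarith
  rw [div_le_div_iff₀ (by linarith) hC]
  have hq : n ^ 2 ≤ 4 * ((n - 1) * (n - 2)) := by nlinarith
  have h1 := mul_le_mul_of_nonneg_left hlow (by linarith : (0 : ℝ) ≤ n)
  have h2 := mul_le_mul_of_nonneg_left hq (by linarith : (0 : ℝ) ≤ n)
  nlinarith

end FGraph

theorem mantel_key_inequality (φ : FGraph → ℝ) (hφ : IsLimitGraph φ) :
    φ (FGraph.edgeless 3) - (1 / 3) * φ FGraph.oneEdge3 - (1 / 3) * φ FGraph.path3 +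
      φ (FGraph.completeG 3) ≥ 0 := by
  obtain ⟨Gs, hinc, hlim⟩ := hφ
  have hcard : Tendsto (fun n => (Gs n).verts.card) atTop atTop :=
    (strictMono_nat_of_lt_succ hinc).tendsto_atTop
  have hL := (((hlim (FGraph.edgeless 3)).sub ((hlim FGraph.oneEdge3).const_mul (1 / 3))).sub
    ((hlim FGraph.path3).const_mul (1 / 3))).add (hlim (FGraph.completeG 3))
  have hzero : Tendsto (fun n => -4 / ((Gs n).verts.card : ℝ)) atTop (𝓝 0) :=
    (tendsto_const_div_atTop_nhds_zero_nat (-4 : ℝ)).comp hcard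
  refine le_of_tendsto_of_tendsto hzero hL ?_
  filter_upwards [hcard.eventually_ge_atTop 4] with n hn
  exact (Gs n).neg_four_div_card_le hn
end

section
/- (Asymptotic Mantel bound.) For every limiting graph φ, if φ(K_3) = 0 then φ(K_2) ≤ 1/2, where K_2 and K_3 are the complete graphs on vertex sets [2] and [3] respectively. -/
open Filter Topology MeasureTheory

namespace FGraph

theorem exists_bijOn_of_card_eq {A B : Finset ℕ} (h : A.card = B.card) :
    ∃ f : ℕ → ℕ, Set.BijOn f ↑A ↑B := by
  let e := Finset.equivOfCardEq h
  refine ⟨fun i => if hi : i ∈ A then (e ⟨i, hi⟩ : ℕ) else 0, ?_, ?_, ?_⟩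
  · intro i hi
    have hi' : i ∈ A := hi
    simp [hi']
  · intro i hi j hj hij
    have hi' : i ∈ A := hi
    have hj' : j ∈ A := hj
    simpa [hi', hj', Subtype.ext_iff] using hij
  · intro b hb
    have hb' : b ∈ B := hb
    refine ⟨e.symm ⟨b, hb'⟩, (e.symm ⟨b, hb'⟩).2, ?_⟩
    simp

theorem iso_completeG_induce_iff (G : FGraph) (U : Finset ℕ) (t : ℕ) :
    Iso (completeG t) (G.induce U) ↔
      U.card = t ∧ ∀ a ∈ U, ∀ b ∈ U, a ≠ b → G.Adj a b := by
  constructor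
  · rintro ⟨f, hf, hadj⟩
    have hf' : Set.BijOn f ↑(Finset.Icc 1 t) ↑U := hf
    constructor
    · simpa using (Finset.card_nbij f hf'.mapsTo hf'.injOn hf'.surjOn).symm
    · intro a ha b hb hab
      obtain ⟨i, hi, rfl⟩ := hf'.surjOn ha
      obtain ⟨j, hj, rfl⟩ := hf'.surjOn hb
      have hij : i ≠ j := fun h => hab (congrArg f h)
      exact ((hadj i hi j hj).1 ⟨hi, hj, hij, Or.inl trivial⟩).2.2
  · rintro ⟨hc, h⟩
    obtain ⟨f, hf⟩ := exists_bijOn_of_card_eq (A := Finset.Icc 1 t) (B := U) (by simp [hc])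
    refine ⟨f, hf, fun i hi j hj => ⟨?_, ?_⟩⟩
    · rintro ⟨-, -, hij, -⟩
      exact ⟨hf.mapsTo hi, hf.mapsTo hj,
        h _ (hf.mapsTo hi) _ (hf.mapsTo hj) fun e => hij (hf.injOn hi hj e)⟩
    · rintro ⟨-, -, hij⟩
      exact ⟨hi, hj, fun e => G.irrefl (f i) (by subst e; exact hij), Or.inl trivial⟩

open Classical in
/-- The sets of `t` pairwise adjacent vertices of `G`. -/
noncomputable def cliques (G : FGraph) (t : ℕ) : Finset (Finset ℕ) :=
  (G.verts.powersetCard t).filter fun U => ∀ a ∈ U, ∀ b ∈ U, a ≠ b → G.Adj a b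

theorem mem_cliques {G : FGraph} {t : ℕ} {U : Finset ℕ} :
    U ∈ G.cliques t ↔ (U ⊆ G.verts ∧ U.card = t) ∧ ∀ a ∈ U, ∀ b ∈ U, a ≠ b → G.Adj a b := by
  simp [cliques, Finset.mem_powersetCard]

theorem density_completeG (G : FGraph) (t : ℕ) :
    density (completeG t) G = ((G.cliques t).card : ℝ) / (G.verts.card.choose t : ℝ) := by
  have hc : (completeG t).verts.card = t := by simp [completeG, ofRel]
  unfold density
  rw [hc, Finset.card_powersetCard]
  congr 3
  ext U
  simp only [Finset.mem_filter, mem_cliques, Finset.mem_powersetCard, iso_completeG_induce_iff]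
  tauto

open Classical in
/-- The adjacency indicator of `G`. -/
noncomputable def adjInd (G : FGraph) (u v : ℕ) : ℝ := if G.Adj u v then 1 else 0

theorem adjInd_symm (G : FGraph) (u v : ℕ) : G.adjInd u v = G.adjInd v u := by
  have : G.Adj u v ↔ G.Adj v u := ⟨G.symm _ _, G.symm _ _⟩
  by_cases h : G.Adj u v
  · simp [adjInd, h, this.1 h]
  · simp [adjInd, h, mt this.2 h]

theorem adjInd_mul_le (G : FGraph) (u v w : ℕ) :
    G.adjInd u v * G.adjInd u w + G.adjInd v u * G.adjInd v w - G.adjInd u v ≤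
      G.adjInd u v * G.adjInd u w * G.adjInd v w := by
  rw [G.adjInd_symm v u]
  unfold adjInd
  split_ifs <;> norm_num

open Classical in
theorem sum_adjInd (G : FGraph) :
    ∑ u ∈ G.verts, ∑ v ∈ G.verts, G.adjInd u v = 2 * ((G.cliques 2).card : ℝ) := by
  let P := (G.verts ×ˢ G.verts).filter fun p => G.Adj p.1 p.2
  have hP : ∑ u ∈ G.verts, ∑ v ∈ G.verts, G.adjInd u v = (P.card : ℝ) := by
    rw [← Finset.sum_product']
    simp [P, adjInd]
  have hcard : P.card = (G.cliques 2).card * 2 := by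
    have hmaps : ∀ p ∈ P, ({p.1, p.2} : Finset ℕ) ∈ G.cliques 2 := by
      rintro ⟨a, b⟩ hp
      simp only [P, Finset.mem_filter, Finset.mem_product] at hp
      obtain ⟨⟨ha, hb⟩, hab⟩ := hp
      have nab : a ≠ b := fun e => G.irrefl a (by rw [← e] at hab; exact hab)
      have hba := G.symm _ _ hab
      rw [mem_cliques]
      refine ⟨⟨by simp [Finset.insert_subset_iff, ha, hb], Finset.card_pair nab⟩, ?_⟩
      simp only [Finset.mem_insert, Finset.mem_singleton]
      rintro x (rfl | rfl) y (rfl | rfl) hxy <;> first | assumption | exact absurd rfl hxy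
    rw [Finset.card_eq_sum_card_fiberwise hmaps]
    refine Finset.sum_const_nat fun U hU => ?_
    obtain ⟨⟨hUV, hU2⟩, hadj⟩ := mem_cliques.1 hU
    obtain ⟨x, y, hxy, rfl⟩ := Finset.card_eq_two.1 hU2
    have hx : x ∈ G.verts := hUV (by simp)
    have hy : y ∈ G.verts := hUV (by simp)
    have axy : G.Adj x y := hadj x (by simp) y (by simp) hxy
    have ayx := G.symm _ _ axy
    rw [← Finset.card_pair (a := (x, y)) (b := (y, x)) (by simp [hxy])]
    congr 1
    ext ⟨a, b⟩
    simp only [P, Finset.mem_filter, Finset.mem_product, Finset.mem_insert, Finset.mem_singleton,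
      Prod.mk.injEq, ← Finset.coe_inj, Finset.coe_pair, Set.pair_eq_pair_iff]
    constructor
    · exact fun h => h.2
    · rintro (⟨rfl, rfl⟩ | ⟨rfl, rfl⟩) <;> simp [*]
  rw [hP, hcard]
  push_cast
  ring

open Classical in
theorem sum_adjInd_triangle_le (G : FGraph) :
    ∑ u ∈ G.verts, ∑ v ∈ G.verts, ∑ w ∈ G.verts,
        G.adjInd u v * G.adjInd u w * G.adjInd v w ≤ 27 * ((G.cliques 3).card : ℝ) := by
  let P := (G.verts ×ˢ G.verts ×ˢ G.verts).filter
    fun p => G.Adj p.1 p.2.1 ∧ G.Adj p.1 p.2.2 ∧ G.Adj p.2.1 p.2.2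
  have hP : ∑ u ∈ G.verts, ∑ v ∈ G.verts, ∑ w ∈ G.verts,
        G.adjInd u v * G.adjInd u w * G.adjInd v w = (P.card : ℝ) := by
    rw [Finset.card_filter, Finset.sum_product]
    push_cast
    refine Finset.sum_congr rfl fun u _ => ?_
    rw [Finset.sum_product]
    refine Finset.sum_congr rfl fun v _ => Finset.sum_congr rfl fun w _ => ?_
    unfold adjInd
    split_ifs <;> simp_all
  have hcard : P.card ≤ 27 * (G.cliques 3).card := by
    refine Finset.card_le_mul_card_image_of_maps_to
      (f := fun p => ({p.1, p.2.1, p.2.2} : Finset ℕ)) ?_ 27 ?_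
    · rintro ⟨a, b, c⟩ hp
      simp only [P, Finset.mem_filter, Finset.mem_product] at hp
      obtain ⟨⟨ha, hb, hc⟩, hab, hac, hbc⟩ := hp
      have nab : a ≠ b := fun e => G.irrefl a (by rw [← e] at hab; exact hab)
      have nac : a ≠ c := fun e => G.irrefl a (by rw [← e] at hac; exact hac)
      have nbc : b ≠ c := fun e => G.irrefl b (by rw [← e] at hbc; exact hbc)
      have hba := G.symm _ _ hab
      have hca := G.symm _ _ hac
      have hcb := G.symm _ _ hbc
      rw [mem_cliques]
      refine ⟨⟨?_, Finset.card_eq_three.2 ⟨a, b, c, nab, nac, nbc, rfl⟩⟩, ?_⟩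
      · simp [Finset.insert_subset_iff, ha, hb, hc]
      · simp only [Finset.mem_insert, Finset.mem_singleton]
        rintro x (rfl | rfl | rfl) y (rfl | rfl | rfl) hxy <;>
          first | assumption | exact absurd rfl hxy
    · intro U hU
      have h3 := (mem_cliques.1 hU).1.2
      calc _ ≤ (U ×ˢ U ×ˢ U).card := by
            refine Finset.card_le_card ?_
            rintro ⟨a, b, c⟩ hp
            have := (Finset.mem_filter.1 hp).2
            simp [← this]
        _ = 27 := by simp [h3]
  rw [hP]
  exact_mod_cast hcard

/-- If `G` has `n` vertices, then `2 E² ≤ n² E + n T` with `E` the number of ordered edges and `T`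
an upper bound for the number of ordered triangles. -/
theorem goodman_bound (G : FGraph) :
    2 * (2 * ((G.cliques 2).card : ℝ)) ^ 2 ≤
      (G.verts.card : ℝ) ^ 2 * (2 * ((G.cliques 2).card : ℝ)) +
        G.verts.card * (27 * ((G.cliques 3).card : ℝ)) := by
  set n : ℝ := (G.verts.card : ℝ) with hn
  let d : ℕ → ℝ := fun u => ∑ v ∈ G.verts, G.adjInd u v
  have hsq : ∑ u ∈ G.verts, ∑ v ∈ G.verts, ∑ w ∈ G.verts, G.adjInd u v * G.adjInd u w =
      ∑ u ∈ G.verts, d u ^ 2 := by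
    refine Finset.sum_congr rfl fun u _ => ?_
    rw [sq, Finset.sum_mul_sum]
  have hsq' : ∑ u ∈ G.verts, ∑ v ∈ G.verts, ∑ w ∈ G.verts, G.adjInd v u * G.adjInd v w =
      ∑ u ∈ G.verts, d u ^ 2 := by
    rw [Finset.sum_comm, hsq]
  have hE := G.sum_adjInd
  have hT := G.sum_adjInd_triangle_le
  have hle := Finset.sum_le_sum fun u (_ : u ∈ G.verts) =>
    Finset.sum_le_sum fun v (_ : v ∈ G.verts) =>
      Finset.sum_le_sum fun w (_ : w ∈ G.verts) => G.adjInd_mul_le u v w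
  simp only [Finset.sum_sub_distrib, Finset.sum_add_distrib] at hle
  rw [hsq, hsq'] at hle
  simp only [Finset.sum_const, nsmul_eq_mul, ← Finset.mul_sum] at hle
  rw [hE, ← hn] at hle
  have hcs : (∑ u ∈ G.verts, d u) ^ 2 ≤ n * ∑ u ∈ G.verts, d u ^ 2 := sq_sum_le_card_mul_sum_sq
  rw [show ∑ u ∈ G.verts, d u = _ from hE] at hcs
  have hn0 : 0 ≤ n := Nat.cast_nonneg _
  nlinarith [mul_le_mul_of_nonneg_left (hle.trans (by simpa only [Finset.mul_sum] using hT)) hn0]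

/-- Mantel's inequality for densities, with an error term controlled by the triangle density. -/
theorem density_bound (G : FGraph) (hG : 3 ≤ G.verts.card) :
    2 * (density (completeG 2) G * (1 - 1 / (G.verts.card : ℝ))) ^ 2 ≤
      density (completeG 2) G * (1 - 1 / (G.verts.card : ℝ)) + 27 * density (completeG 3) G := by
  have hb := G.goodman_bound
  have h2 := G.density_completeG 2
  have h3 := G.density_completeG 3
  have c3 : ((G.verts.card.choose 3 : ℕ) : ℝ) ≤ (G.verts.card : ℝ) ^ 3 := by
    exact_mod_cast Nat.choose_le_pow G.verts.card 3
  have p3 : (0 : ℝ) < (G.verts.card.choose 3 : ℕ) := by exact_mod_cast Nat.choose_pos hG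
  rw [Nat.cast_choose_two] at h2
  have hn : (3 : ℝ) ≤ G.verts.card := by exact_mod_cast hG
  set n : ℝ := (G.verts.card : ℝ)
  set p := density (completeG 2) G
  set q := density (completeG 3) G
  have hq0 : 0 ≤ q := by rw [h3]; positivity
  have e2 : 2 * ((G.cliques 2).card : ℝ) = n ^ 2 * (p * (1 - 1 / n)) := by
    have : n - 1 ≠ 0 := by linarith
    rw [h2]
    field_simp
  have e3 : ((G.cliques 3).card : ℝ) ≤ q * n ^ 3 := by
    rw [eq_div_iff p3.ne'] at h3
    rw [← h3]
    gcongr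
  rw [e2] at hb
  set x := p * (1 - 1 / n)
  have hn4 : 0 < n ^ 4 := by positivity
  have : n ^ 4 * (2 * x ^ 2) ≤ n ^ 4 * (x + 27 * q) := by
    nlinarith [mul_le_mul_of_nonneg_left e3 (by linarith : (0 : ℝ) ≤ n)]
  exact le_of_mul_le_mul_left this hn4

end FGraph

theorem asymptotic_mantel (φ : FGraph → ℝ) (hφ : IsLimitGraph φ)
    (h : φ (FGraph.completeG 3) = 0) :
    φ (FGraph.completeG 2) ≤ 1 / 2 := by
  obtain ⟨Gs, hinc, hlim⟩ := hφ
  have hcard : Tendsto (fun n => (Gs n).verts.card) atTop atTop :=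
    (strictMono_nat_of_lt_succ hinc).tendsto_atTop
  have hq : Tendsto (fun n => 1 - 1 / ((Gs n).verts.card : ℝ)) atTop (𝓝 1) := by
    simpa using (tendsto_one_div_atTop_nhds_zero_nat (𝕜 := ℝ)).comp hcard |>.const_sub 1
  have h2 := (hlim (FGraph.completeG 2)).mul hq
  have h3 := hlim (FGraph.completeG 3)
  rw [h] at h3
  have key := le_of_tendsto_of_tendsto ((h2.pow 2).const_mul 2) (h2.add (h3.const_mul 27))
    ((hcard.eventually_ge_atTop 3).mono fun n hn => (Gs n).density_bound hn)
  nlinarith [key]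
end

section
/- (Transfer via an adjoint pair.) Let τ be a type of size k. Let α map each τ-labelled graph H^τ to a finitely supported finite measure α(H^τ) on the set 𝒢 of graphs (with the discrete σ-algebra), and let γ map each graph G to a finite measure γ(G) on the set 𝒢^τ of τ-labelled graphs (with the discrete σ-algebra), such that for all H^τ ∈ 𝒢^τ and G ∈ 𝒢: ∫_𝒢 p(H,G) dα(H^τ)(H) = ∫_{𝒢^τ} p_τ(H^τ,G^τ) dγ(G)(G^τ). Suppose γ is extendible to limiting graphs: there exists a map γ_∞ from the set Φ of limiting graphs to finite measures on the set Φ^τ of τ-labelled limiting graphs (viewed as a subset of [0,1]^{𝒢^τ} with the Borel σ-algebra of the product topology) such that for every convergent sequence of graphs (G_n) and every φ ∈ Φ with φ(H) = lim_n p(H,G_n) for all H ∈ 𝒢, it holds for all H^τ ∈ 𝒢^τ that lim_n ∫_{𝒢^τ} p_τ(H^τ,G^τ) dγ(G_n)(G^τ) = ∫_{Φ^τ} φ^τ(H^τ) dγ_∞(φ)(φ^τ). Then for all m ∈ ℕ, τ-labelled graphs H_1^τ,…,H_m^τ and real numbers c_1,…,c_m: if Σ_{i=1}^m c_i·φ^τ(H_i^τ)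 ≥ 0 for every τ-labelled limiting graph φ^τ ∈ Φ^τ, then Σ_{i=1}^m c_i·(Σ_{H ∈ 𝒢} α(H_i^τ)({H})·φ(H)) ≥ 0 for every limiting graph φ ∈ Φ. -/
open Filter Topology MeasureTheory

theorem FGraph.verts_adj_injective :
    Function.Injective fun G : FGraph =>
      (G.verts, {e : G.verts × G.verts | G.Adj e.1 e.2}.toFinite.toFinset.image
        fun e => ((e.1 : ℕ), (e.2 : ℕ))) := by
  intro G H h
  have hv : G.verts = H.verts := congrArg Prod.fst h
  have he := congrArg Prod.snd h
  have hA : G.Adj = H.Adj := by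
    funext a b
    have hab := Finset.ext_iff.1 he (a, b)
    have aux : ∀ K : FGraph, (a, b) ∈ ({e : K.verts × K.verts | K.Adj e.1 e.2}.toFinite.toFinset.image
        fun e => ((e.1 : ℕ), (e.2 : ℕ))) ↔ K.Adj a b := by
      intro K
      simp only [Finset.mem_image, Set.Finite.mem_toFinset, Set.mem_ofPred_eq, Prod.mk.injEq]
      constructor
      · rintro ⟨e, he, rfl, rfl⟩
        exact he
      · intro hK
        exact ⟨(⟨a, (K.mem a b hK).1⟩, ⟨b, (K.mem a b hK).2⟩), hK, rfl, rfl⟩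
    exact propext ((aux G).symm.trans (hab.trans (aux H)))
  cases G
  cases H
  simp_all

instance : Countable FGraph := FGraph.verts_adj_injective.countable

theorem FGraph.density_mem_Icc (H G : FGraph) : FGraph.density H G ∈ Set.Icc (0 : ℝ) 1 := by
  classical
  exact ⟨by unfold FGraph.density; positivity,
    div_le_one_of_le₀ (by exact_mod_cast Finset.card_filter_le _ _) (by positivity)⟩

theorem ldensity_mem_Icc {τ : FGraph} (Hτ Gτ : LGraph τ) :
    ldensity Hτ Gτ ∈ Set.Icc (0 : ℝ) 1 := by
  classical
  exact ⟨by unfold ldensity; positivity,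
    div_le_one_of_le₀ (by exact_mod_cast Finset.card_filter_le _ _) (by positivity)⟩

theorem IsLimitLGraph.mem_Icc {τ : FGraph} {ψ : LGraph τ → ℝ} (hψ : IsLimitLGraph ψ)
    (Hτ : LGraph τ) : ψ Hτ ∈ Set.Icc (0 : ℝ) 1 := by
  obtain ⟨Gs, -, h⟩ := hψ
  exact isClosed_Icc.mem_of_tendsto (h Hτ) (Eventually.of_forall fun n => ldensity_mem_Icc _ _)

theorem integrable_eval_limitLGraph {τ : FGraph}
    (μ : Measure {ψ : LGraph τ → ℝ // IsLimitLGraph ψ}) [IsFiniteMeasure μ] (Hτ : LGraph τ) :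
    Integrable (fun ψ => ψ.1 Hτ) μ := by
  have : BorelSpace {ψ : LGraph τ → ℝ // IsLimitLGraph ψ} := ⟨rfl⟩
  have hc : Continuous fun ψ : {ψ : LGraph τ → ℝ // IsLimitLGraph ψ} => ψ.1 Hτ :=
    (continuous_apply Hτ).comp continuous_subtype_val
  refine Integrable.of_bound hc.measurable.aestronglyMeasurable 1 (ae_of_all _ fun ψ => ?_)
  obtain ⟨h0, h1⟩ := ψ.2.mem_Icc Hτ
  rwa [Real.norm_of_nonneg h0]

theorem integral_density_eq_finset_sum (μ : Measure FGraph) [IsFiniteMeasure μ]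
    (hμ : {H : FGraph | μ {H} ≠ 0}.Finite) (G : FGraph) :
    ∫ H, FGraph.density H G ∂μ = ∑ H ∈ hμ.toFinset, (μ {H}).toReal * FGraph.density H G := by
  have : DiscreteMeasurableSpace FGraph := ⟨fun _ => trivial⟩
  have hint : Integrable (fun H => FGraph.density H G) μ := by
    refine Integrable.of_bound Measurable.of_discrete.aestronglyMeasurable 1
      (ae_of_all _ fun H => ?_)
    obtain ⟨h0, h1⟩ := H.density_mem_Icc G
    rwa [Real.norm_of_nonneg h0]
  rw [integral_countable hint]
  refine tsum_eq_sum fun H hH => ?_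
  simp_all [Measure.real]

theorem tendsto_integral_density (μ : Measure FGraph) [IsFiniteMeasure μ]
    (hμ : {H : FGraph | μ {H} ≠ 0}.Finite) {Gs : ℕ → FGraph} {φ : FGraph → ℝ}
    (hφ : ∀ H : FGraph, Tendsto (fun n => FGraph.density H (Gs n)) atTop (𝓝 (φ H))) :
    Tendsto (fun n => ∫ H, FGraph.density H (Gs n) ∂μ) atTop
      (𝓝 (∑ᶠ H : FGraph, (μ {H}).toReal * φ H)) := by
  have hsum : ∑ᶠ H : FGraph, (μ {H}).toReal * φ H
      = ∑ H ∈ hμ.toFinset, (μ {H}).toReal * φ H := by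
    refine finsum_eq_sum_of_support_subset _ fun H hH => ?_
    simp only [Set.Finite.coe_toFinset, Set.mem_ofPred_eq]
    intro h0
    simp [h0] at hH
  simp only [hsum, integral_density_eq_finset_sum μ hμ]
  exact tendsto_finsetSum _ fun H _ => (hφ H).const_mul _

theorem adjoint_transfer (τ : FGraph) (k : ℕ) (hτ : τ.verts = Finset.Icc 1 k)
    (α : LGraph τ → Measure FGraph) (γ : FGraph → Measure (LGraph τ))
    (hαfin : ∀ Hτ : LGraph τ, IsFiniteMeasure (α Hτ))
    (hαsupp : ∀ Hτ : LGraph τ, {H : FGraph | α Hτ {H} ≠ 0}.Finite)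
    (hγfin : ∀ G : FGraph, IsFiniteMeasure (γ G))
    (hadj : ∀ (Hτ : LGraph τ) (G : FGraph),
      ∫ H, FGraph.density H G ∂(α Hτ) = ∫ Gτ, ldensity Hτ Gτ ∂(γ G))
    (γlim : (FGraph → ℝ) → Measure {ψ : LGraph τ → ℝ // IsLimitLGraph ψ})
    (hγlimfin : ∀ φ : FGraph → ℝ, IsFiniteMeasure (γlim φ))
    (hext : ∀ (Gs : ℕ → FGraph) (φ : FGraph → ℝ),
      IncreasingSeq Gs →
      (∀ H : FGraph, Tendsto (fun n => FGraph.density H (Gs n)) atTop (𝓝 (φ H))) →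
      ∀ Hτ : LGraph τ,
        Tendsto (fun n => ∫ Gτ, ldensity Hτ Gτ ∂(γ (Gs n))) atTop
          (𝓝 (∫ ψ, ψ.1 Hτ ∂(γlim φ))))
    (m : ℕ) (Hs : Fin m → LGraph τ) (c : Fin m → ℝ)
    (hvalid : ∀ ψ : LGraph τ → ℝ, IsLimitLGraph ψ → 0 ≤ ∑ i, c i * ψ (Hs i)) :
    ∀ φ : FGraph → ℝ, IsLimitGraph φ →
      0 ≤ ∑ i, c i * ∑ᶠ H : FGraph, (α (Hs i) {H}).toReal * φ H := by
  rintro φ ⟨Gs, hinc, hφ⟩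
  have hα : ∀ i, ∑ᶠ H : FGraph, (α (Hs i) {H}).toReal * φ H = ∫ ψ, ψ.1 (Hs i) ∂(γlim φ) := by
    intro i
    have := hαfin (Hs i)
    have h := tendsto_integral_density (α (Hs i)) (hαsupp (Hs i)) hφ
    simp only [hadj] at h
    exact tendsto_nhds_unique h (hext Gs φ hinc hφ (Hs i))
  have := hγlimfin φ
  simp only [hα, ← integral_const_mul]
  rw [← integral_finsetSum _ fun i _ => (integrable_eval_limitLGraph _ (Hs i)).const_mul _]
  exact integral_nonneg fun ψ => hvalid ψ.1 ψ.2
end
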